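/- Fix μ ∈ V*_ℂ and let s₀(v) = v + (1 − φ(v))φ∨ denote the reflection in the affine root a₀ = (−φ,1). Define g : V → ℂ by g(v) = e^{μ(s₀(v))} + k_φ·∫₀^{1−φ(v)} e^{μ(v + tφ∨)} dt (this is the integral-reflection operator Q_k(a₀) applied to e^μ). Then g is smooth and for every v ∈ V: (∂_{φ∨} g)(v) + k_φ·e^{μ(v)} = −(μ(φ∨) + k_φ)·e^{μ(φ∨)}·e^{(s_φ μ)(v)}, where s_φ μ = μ − μ(φ∨)·φ. (In the paper's notation, 𝒥_k e^μ = −(μ(φ∨)+k_φ)·e^{μ(φ∨)}·e^{s_φ μ}, where 𝒥_k = ∂_{φ∨}∘Q_k(a₀) + k_φ is the affine intertwiner.) -/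

import Mathlib

open scoped BigOperators
open RealInnerProductSpace

noncomputable section

/-- The coroot `α∨` of a root `α`, under the identification of `V*` with `V`
via the inner product: `ξ(α∨) = 2⟨ξ,α⟩/‖α‖²`. -/
def coroot {V : Type*} [NormedAddCommGroup V] [InnerProductSpace ℝ V] (α : V) : V :=
  (2 / ‖α‖ ^ 2) • α

/-- The orthogonal reflection `s_α` in the hyperplane orthogonal to `α`:
`s_α(ξ) = ξ − ξ(α∨)·α = ξ − α(ξ)·α∨`. -/
def sRefl {V : Type*} [NormedAddCommGroup V] [InnerProductSpace ℝ V] (α v : V) : V :=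
  v - ⟪α, v⟫ • coroot α

/-- A finite, irreducible, reduced, crystallographic root system `Σ₀` in the dual of
the Euclidean space `V` (identified with `V` via the inner product), together with a
fixed base of simple roots, the positive roots, and the highest root. -/
structure RootSystemBase (V : Type*) [NormedAddCommGroup V] [InnerProductSpace ℝ V]
    [FiniteDimensional ℝ V] where
  roots : Finset V
  roots_nonempty : roots.Nonempty
  ne_zero : ∀ α ∈ roots, α ≠ (0 : V)
  /-- reduced -/
  reduced : ∀ α ∈ roots, ∀ c : ℝ, c • α ∈ roots → c = 1 ∨ c = -1
  /-- crystallographic: `β(α∨) ∈ ℤ` -/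
  crystallographic : ∀ α ∈ roots, ∀ β ∈ roots, ∃ m : ℤ, ⟪β, coroot α⟫ = (m : ℝ)
  /-- stable under the reflections `s_α` -/
  refl_mem : ∀ α ∈ roots, ∀ β ∈ roots, sRefl α β ∈ roots
  /-- `Σ₀` spans `V*` -/
  spanning : Submodule.span ℝ (roots : Set V) = ⊤
  /-- irreducible: no nontrivial orthogonal decomposition -/
  irreducible : ∀ s : Finset V, s ⊆ roots →
    (∀ α ∈ s, ∀ β ∈ roots, β ∉ s → ⟪α, β⟫ = 0) → s = ∅ ∨ s = roots
  /-- the fixed base of simple roots -/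
  simples : Finset V
  simples_sub : simples ⊆ roots
  simples_indep : LinearIndependent ℝ (fun β : {x // x ∈ simples} => (β : V))
  /-- the positive roots w.r.t. the base -/
  pos : Finset V
  pos_sub : pos ⊆ roots
  simples_sub_pos : simples ⊆ pos
  pos_or_neg : ∀ α ∈ roots, (α ∈ pos ∧ -α ∉ pos) ∨ (α ∉ pos ∧ -α ∈ pos)
  pos_combo : ∀ α ∈ pos, ∃ c : V → ℝ, (∀ β, 0 ≤ c β) ∧ α = ∑ β ∈ simples, c β • β
  /-- the highest root `φ` -/
  hroot : V
  hroot_pos : hroot ∈ pos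
  hroot_highest : ∀ α ∈ roots, ∃ c : V → ℝ, (∀ β, 0 ≤ c β) ∧
    hroot - α = ∑ β ∈ simples, c β • β

variable {V : Type*} [NormedAddCommGroup V] [InnerProductSpace ℝ V] [FiniteDimensional ℝ V]

/-- The Weyl group `W₀`: the subgroup of linear automorphisms of `V` generated by the
orthogonal reflections in the roots. -/
def weylGroup (R : RootSystemBase V) : Subgroup (V ≃ₗ[ℝ] V) :=
  Subgroup.closure {w : V ≃ₗ[ℝ] V | ∃ α ∈ R.roots, ∀ v, w v = sRefl α v}

/-- A strictly positive `W₀`-invariant multiplicity function. -/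
def IsMultiplicity (R : RootSystemBase V) (k : V → ℝ) : Prop :=
  (∀ α ∈ R.roots, 0 < k α) ∧
  (∀ w : V ≃ₗ[ℝ] V, w ∈ weylGroup R → ∀ α ∈ R.roots, k (w α) = k α)

/-- `σ_η^k = Σ_{α∈Σ₀} arctan(η(α∨)/k_α)·α`. -/
def sigmaFun (R : RootSystemBase V) (k : V → ℝ) (η : V) : V :=
  ∑ α ∈ R.roots, Real.arctan (⟪η, coroot α⟫ / k α) • α

/-- The master function
`S_k(μ,ξ) = ½‖ξ‖² − 2π⟨μ,ξ⟩ + ½ Σ_{α∈Σ₀} ‖α‖² ∫₀^{ξ(α∨)} arctan(t/k_α) dt`. -/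
def masterFun (R : RootSystemBase V) (k : V → ℝ) (μ ξ : V) : ℝ :=
  ‖ξ‖ ^ 2 / 2 - 2 * Real.pi * ⟪μ, ξ⟫ +
    (1 / 2) * ∑ α ∈ R.roots, ‖α‖ ^ 2 * ∫ t in (0:ℝ)..(⟪ξ, coroot α⟫), Real.arctan (t / k α)

/-- Membership in the weight lattice `P = {λ ∈ V* : λ(α∨) ∈ ℤ ∀α ∈ Σ₀}`. -/
def IsWeight (R : RootSystemBase V) (lam : V) : Prop :=
  ∀ α ∈ R.roots, ∃ m : ℤ, ⟪lam, coroot α⟫ = (m : ℝ)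

/-- `η ∈ V*` is a Bethe root: `λ = iη` solves the Bethe ansatz equations
`e^{(wλ)(φ∨)} = ∏_{α∈Σ₀⁺} ((wλ)(α∨) − k_α)/((wλ)(α∨) + k_α))^{α(φ∨)}` for all `w ∈ W₀`,
where `m α = α(φ∨) ∈ ℤ≥0`. -/
def IsBetheRoot (R : RootSystemBase V) (k : V → ℝ) (m : V → ℕ) (η : V) : Prop :=
  ∀ w : V ≃ₗ[ℝ] V, w ∈ weylGroup R →
    Complex.exp (Complex.I * (⟪w η, coroot R.hroot⟫ : ℝ)) =
      ∏ α ∈ R.pos,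
        ((Complex.I * (⟪w η, coroot α⟫ : ℝ) - (k α : ℂ)) /
         (Complex.I * (⟪w η, coroot α⟫ : ℝ) + (k α : ℂ))) ^ (m α)

end

noncomputable section

theorem inner_coroot_self {V : Type*} [NormedAddCommGroup V] [InnerProductSpace ℝ V]
    {α : V} (hα : α ≠ 0) : ⟪α, coroot α⟫ = 2 := by
  have : ‖α‖ ≠ 0 := norm_ne_zero_iff.mpr hα
  rw [coroot, real_inner_smul_right, real_inner_self_eq_norm_sq]
  field_simp

/-- The primitive `x ↦ ∫₀ˣ e^{tm} dt`. -/
def expPrimitive (m : ℂ) (x : ℝ) : ℂ :=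
  ∫ t in (0:ℝ)..x, Complex.exp (t * m)

theorem hasDerivAt_expPrimitive (m : ℂ) (x : ℝ) :
    HasDerivAt (expPrimitive m) (Complex.exp (x * m)) x := by
  have hc : Continuous fun t : ℝ => Complex.exp (t * m) := by fun_prop
  exact hc.integral_hasStrictDerivAt 0 x |>.hasDerivAt

theorem contDiff_expPrimitive (m : ℂ) : ContDiff ℝ (⊤ : ℕ∞) (expPrimitive m) := by
  refine contDiff_infty_iff_deriv.mpr
    ⟨fun x => (hasDerivAt_expPrimitive m x).differentiableAt, ?_⟩
  rw [funext fun x => (hasDerivAt_expPrimitive m x).deriv]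
  exact (Complex.ofRealCLM.contDiff.mul contDiff_const).cexp

theorem mul_expPrimitive (m : ℂ) (x : ℝ) :
    m * expPrimitive m x = Complex.exp (x * m) - 1 := by
  by_cases hm : m = 0
  · simp [hm]
  · have h := integral_exp_mul_complex (a := 0) (b := x) hm
    simp only [mul_comm m, Complex.ofReal_zero, zero_mul, Complex.exp_zero] at h
    rw [expPrimitive, h]
    field_simp

/-- Fix `μ ∈ V*_ℂ` and let `s₀(v) = v + (1 − φ(v))φ∨` be the affine
reflection in `a₀ = (−φ,1)`. Then
`g(v) = e^{μ(s₀(v))} + k_φ ∫₀^{1−φ(v)} e^{μ(v + tφ∨)} dt` (the integral-reflection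
operator `Q_k(a₀)` applied to `e^μ`) is smooth, and for every `v`:
`(∂_{φ∨}g)(v) + k_φ e^{μ(v)} = −(μ(φ∨)+k_φ)·e^{μ(φ∨)}·e^{(s_φμ)(v)}`,
where `(s_φμ)(v) = μ(v) − μ(φ∨)φ(v)`. -/
theorem statement19
    {V : Type*} [NormedAddCommGroup V] [InnerProductSpace ℝ V] [FiniteDimensional ℝ V]
    (R : RootSystemBase V) (k : V → ℝ) (hk : IsMultiplicity R k)
    (μ : V →ₗ[ℝ] ℂ) (g : V → ℂ)
    (hg : ∀ v : V, g v =
      Complex.exp (μ (v + (1 - ⟪R.hroot, v⟫) • coroot R.hroot)) +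
        (k R.hroot : ℂ) *
          ∫ t in (0:ℝ)..(1 - ⟪R.hroot, v⟫), Complex.exp (μ (v + t • coroot R.hroot))) :
    ContDiff ℝ (⊤ : ℕ∞) g ∧
    ∀ v : V,
      fderiv ℝ g v (coroot R.hroot) + (k R.hroot : ℂ) * Complex.exp (μ v) =
        -(μ (coroot R.hroot) + (k R.hroot : ℂ)) * Complex.exp (μ (coroot R.hroot)) *
          Complex.exp (μ v - μ (coroot R.hroot) * ((⟪R.hroot, v⟫ : ℝ) : ℂ)) := by
  set c := coroot R.hroot
  set m := μ c
  have hc : ⟪R.hroot, c⟫ = 2 :=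
    inner_coroot_self (R.ne_zero _ (R.pos_sub R.hroot_pos))
  have hg' : g = fun v => Complex.exp (μ v + ((1 - ⟪R.hroot, v⟫ : ℝ) : ℂ) * m) +
      (k R.hroot : ℂ) * (Complex.exp (μ v) * expPrimitive m (1 - ⟪R.hroot, v⟫)) := by
    funext v
    simp only [hg, expPrimitive, map_add, map_smul, Complex.real_smul, Complex.exp_add,
      intervalIntegral.integral_const_mul, m]
  have hμ : ContDiff ℝ (⊤ : ℕ∞) μ := (LinearMap.toContinuousLinearMap μ).contDiff
  have hφ : ContDiff ℝ (⊤ : ℕ∞) fun v : V => 1 - ⟪R.hroot, v⟫ :=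
    contDiff_const.sub (contDiff_const.inner ℝ contDiff_id)
  have hsmooth : ContDiff ℝ (⊤ : ℕ∞) g := by
    rw [hg']
    exact (hμ.add ((Complex.ofRealCLM.contDiff.comp hφ).mul contDiff_const)).cexp.add
      (contDiff_const.mul (hμ.cexp.mul ((contDiff_expPrimitive m).comp hφ)))
  refine ⟨hsmooth, fun v => ?_⟩
  set x : ℝ := 1 - ⟪R.hroot, v⟫ with hx
  have hline : HasDerivAt (fun s : ℝ => g (v + s • c)) (fderiv ℝ g v c) 0 :=
    (hsmooth.differentiable (by simp) v).hasFDerivAt.hasLineDerivAt c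
  have heq : (fun s : ℝ => g (v + s • c)) = fun s : ℝ =>
      Complex.exp (μ v + s * m + ((x - 2 * s : ℝ) : ℂ) * m) +
      (k R.hroot : ℂ) * (Complex.exp (μ v + s * m) * expPrimitive m (x - 2 * s)) := by
    funext s
    have : 1 - ⟪R.hroot, v + s • c⟫ = x - 2 * s := by
      rw [inner_add_right, real_inner_smul_right, hc, hx]; ring
    simp only [hg', this, map_add, map_smul, Complex.real_smul, m]
  have hμs : HasDerivAt (fun s : ℝ => μ v + s * m) m 0 := by
    simpa using ((Complex.ofRealCLM.hasDerivAt (x := (0 : ℝ))).mul_const m).const_add (μ v)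
  have hxs : HasDerivAt (fun s : ℝ => x - 2 * s) (-2) 0 := by
    simpa using ((hasDerivAt_id (0 : ℝ)).const_mul 2).const_sub x
  have hF : HasDerivAt (fun s : ℝ => expPrimitive m (x - 2 * s))
      ((-2 : ℝ) • Complex.exp (x * m)) 0 := by
    refine HasDerivAt.scomp (g₁ := expPrimitive m) (0 : ℝ) ?_ hxs
    simpa using hasDerivAt_expPrimitive m x
  have hder := (hμs.add (hxs.ofReal_comp.mul_const m)).cexp.add
    ((hμs.cexp.mul hF).const_mul (k R.hroot : ℂ))
  rw [heq] at hline
  have hd := hline.unique hder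
  have hE : Complex.exp m * Complex.exp (μ v - m * ((⟪R.hroot, v⟫ : ℝ) : ℂ)) =
      Complex.exp (μ v) * Complex.exp (x * m) := by
    rw [← Complex.exp_add, ← Complex.exp_add, hx]
    push_cast
    ring_nf
  rw [mul_assoc, hE, hd]
  simp only [Pi.add_apply, Complex.ofReal_zero, zero_mul, mul_zero, add_zero, sub_zero,
    Complex.exp_add, Complex.real_smul]
  push_cast
  linear_combination (k R.hroot : ℂ) * Complex.exp (μ v) * mul_expPrimitive m x

end
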